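/- Let g be a weight on ℤ^c satisfying assumptions (a)–(e), and let u = (u_1,…,u_c) ∈ (ℂ∖{0})^c. The formula χ(a) = Σ_{n∈ℤ^c} u^n a_n defines a character of the convolution algebra l_{1,g}(ℤ^c,ℂ) if and only if |u_m| = 1 for every m = 1,…,c. In particular, the character space of l_{1,g}(ℤ^c,ℂ) does not depend on the weight g. -/

import Mathlib

open Filter
open scoped Topology

/-- Convolution of complex-valued families on `ℤ^c`. -/
noncomputable def convC (c : ℕ) (a b : (Fin c → ℤ) → ℂ) : (Fin c → ℤ) → ℂ :=
  fun k => ∑' m, a m * b (k - m)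

/-- The unit family `δ`. -/
noncomputable def deltaC (c : ℕ) : (Fin c → ℤ) → ℂ := fun k => if k = 0 then 1 else 0

/-- The monomial `u^n = u_1^{n_1} ⋯ u_c^{n_c}`. -/
noncomputable def upow (c : ℕ) (u : Fin c → ℂ) (n : Fin c → ℤ) : ℂ :=
  ∏ i, u i ^ (n i)


lemma upow_add_aux (c : ℕ) (u : Fin c → ℂ) (hu : ∀ i, u i ≠ 0) (m n : Fin c → ℤ) :
    upow c u (m + n) = upow c u m * upow c u n := by
  simp only [upow, Pi.add_apply, ← Finset.prod_mul_distrib]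
  exact Finset.prod_congr rfl fun i _ => zpow_add₀ (hu i) _ _

lemma upow_norm_aux (c : ℕ) (u : Fin c → ℂ) (h : ∀ i, ‖u i‖ = 1) (n : Fin c → ℤ) :
    ‖upow c u n‖ = 1 := by
  simp [upow, norm_prod, norm_zpow, h]

lemma upow_single_aux (c : ℕ) (u : Fin c → ℂ) (i : Fin c) (z : ℤ) :
    upow c u (Pi.single i z) = u i ^ z := by
  unfold upow
  rw [Finset.prod_eq_single i]
  · simp
  · intro j _ hj
    simp [Pi.single_eq_of_ne hj]
  · simp

/-- Convolution theorem for absolutely summable families. -/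
lemma conv_aux (c : ℕ) (A B : (Fin c → ℤ) → ℂ) (hA : Summable fun n => ‖A n‖)
    (hB : Summable fun n => ‖B n‖) :
    ∑' k, ∑' m, A m * B (k - m) = (∑' n, A n) * ∑' n, B n := by
  let e : (Fin c → ℤ) × (Fin c → ℤ) ≃ (Fin c → ℤ) × (Fin c → ℤ) :=
    { toFun := fun p => (p.2, p.1 - p.2)
      invFun := fun p => (p.1 + p.2, p.1)
      left_inv := fun p => by ext <;> simp
      right_inv := fun p => by ext <;> simp }
  have hs : Summable fun p : (Fin c → ℤ) × (Fin c → ℤ) => A p.1 * B p.2 :=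
    summable_mul_of_summable_norm hA hB
  have hs2 : Summable fun p : (Fin c → ℤ) × (Fin c → ℤ) => A p.2 * B (p.1 - p.2) :=
    (e.summable_iff (f := fun p : (Fin c → ℤ) × (Fin c → ℤ) => A p.1 * B p.2)).2 hs
  rw [tsum_mul_tsum_of_summable_norm hA hB]
  rw [← e.tsum_eq (fun p : (Fin c → ℤ) × (Fin c → ℤ) => A p.1 * B p.2)]
  exact hs2.tsum_prod.symm

lemma root_aux (x C : ℝ) (hx : 0 ≤ x) (hC : 0 < C) (G : ℕ → ℝ) (hG : ∀ n, 0 < G n)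
    (h : ∀ n, x ^ n ≤ C * G n)
    (hl : Tendsto (fun n : ℕ => G n ^ ((n : ℝ)⁻¹)) atTop (𝓝 1)) : x ≤ 1 := by
  have h1 : Tendsto (fun n : ℕ => C ^ ((n : ℝ)⁻¹)) atTop (𝓝 1) := by
    have := (Real.continuousAt_const_rpow (b := 0) hC.ne').tendsto.comp
      (tendsto_inv_atTop_nhds_zero_nat (𝕜 := ℝ))
    rw [Real.rpow_zero] at this
    exact this
  have h2 := h1.mul hl
  rw [mul_one] at h2
  refine ge_of_tendsto h2 ?_
  filter_upwards [eventually_ne_atTop 0] with n hn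
  rw [← Real.mul_rpow hC.le (hG n).le]
  calc x = (x ^ n) ^ ((n : ℝ)⁻¹) := (Real.pow_rpow_inv_natCast hx hn).symm
    _ ≤ _ := Real.rpow_le_rpow (pow_nonneg hx n) (h n) (by positivity)

/-- For a weight satisfying the GRS condition, `χ(a) = ∑_n u^n a_n` defines a character
of `l_{1,g}(ℤ^c, ℂ)` if and only if `|u_m| = 1` for all `m`; in particular the
character space does not depend on the weight `g`. -/
theorem character_criterion_GRS (c : ℕ) (g : (Fin c → ℤ) → ℝ)
    (hgpos : ∀ n, 0 < g n) (hg0 : g 0 = 1)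
    (hsub : ∀ m n, g (m + n) ≤ g m * g n) (hsymm : ∀ n, g (-n) = g n)
    (hge : ∀ n, 1 ≤ g n)
    (hGRS : ∀ t : Fin c → ℤ,
      Tendsto (fun n : ℕ => (g ((n : ℤ) • t)) ^ ((n : ℝ)⁻¹)) atTop (𝓝 1))
    (u : Fin c → ℂ) (hu : ∀ i, u i ≠ 0) :
    ((∀ a : (Fin c → ℤ) → ℂ, Summable (fun n => g n * ‖a n‖) →
        Summable fun n => ‖upow c u n * a n‖) ∧
      (∃ C : ℝ, ∀ a : (Fin c → ℤ) → ℂ, Summable (fun n => g n * ‖a n‖) →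
        ‖∑' n, upow c u n * a n‖ ≤ C * ∑' n, g n * ‖a n‖) ∧
      (∀ a b : (Fin c → ℤ) → ℂ, Summable (fun n => g n * ‖a n‖) →
        Summable (fun n => g n * ‖b n‖) →
        (∑' n, upow c u n * convC c a b n) =
          (∑' n, upow c u n * a n) * (∑' n, upow c u n * b n)) ∧
      (∑' n, upow c u n * deltaC c n) = 1)
    ↔ ∀ i, ‖u i‖ = 1 := by
  constructor
  · rintro ⟨-, ⟨C, hC⟩, -, -⟩ i
    have key : ∀ n, ‖upow c u n‖ ≤ max C 1 * g n := by
      intro n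
      have hz : ∀ m, m ≠ n → g m * ‖(Pi.single n 1 : (Fin c → ℤ) → ℂ) m‖ = 0 := by
        intro m hm
        simp [Pi.single_eq_of_ne hm]
      have hz2 : ∀ m, m ≠ n → upow c u m * (Pi.single n 1 : (Fin c → ℤ) → ℂ) m = 0 := by
        intro m hm
        simp [Pi.single_eq_of_ne hm]
      have := hC (Pi.single n 1) (hasSum_single n hz).summable
      rw [tsum_eq_single n hz, tsum_eq_single n hz2] at this
      simp only [Pi.single_eq_same, norm_one, mul_one] at this
      exact this.trans (mul_le_mul_of_nonneg_right (le_max_left _ _) (hgpos n).le)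
    have hCp : 0 < max C 1 := lt_max_of_lt_right one_pos
    have hpos : 0 < ‖u i‖ := norm_pos_iff.2 (hu i)
    have hk : ∀ (z : ℤ) (n : ℕ), (n : ℤ) • (Pi.single i z : Fin c → ℤ)
        = (Pi.single i ((n : ℤ) * z) : Fin c → ℤ) := by
      intro z n
      ext j
      by_cases hj : j = i
      · subst hj
        simp
      · simp [Pi.single_eq_of_ne hj]
    have key2 : ∀ (z : ℤ) (n : ℕ), ‖u i‖ ^ ((n : ℤ) * z) ≤
        max C 1 * g ((n : ℤ) • (Pi.single i z : Fin c → ℤ)) := by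
      intro z n
      have := key ((n : ℤ) • (Pi.single i z : Fin c → ℤ))
      rwa [hk, upow_single_aux, norm_zpow, ← hk] at this
    apply le_antisymm
    · refine root_aux _ _ hpos.le hCp (fun n : ℕ => g ((n : ℤ) • (Pi.single i 1 : Fin c → ℤ)))
        (fun n => hgpos _) (fun n => ?_) (hGRS _)
      have := key2 1 n
      rwa [mul_one, zpow_natCast] at this
    · have : ‖u i‖⁻¹ ≤ 1 := by
        refine root_aux _ _ (inv_nonneg.2 hpos.le) hCp
          (fun n : ℕ => g ((n : ℤ) • (Pi.single i (-1) : Fin c → ℤ)))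
          (fun n => hgpos _) (fun n => ?_) (hGRS _)
        have := key2 (-1) n
        rwa [mul_neg_one, zpow_neg, zpow_natCast, ← inv_pow] at this
      exact (inv_le_one₀ hpos).1 this
  · intro h
    have hn := upow_norm_aux c u h
    have hle : ∀ (a : (Fin c → ℤ) → ℂ) n, ‖upow c u n * a n‖ ≤ g n * ‖a n‖ := by
      intro a n
      rw [norm_mul, hn]
      exact mul_le_mul_of_nonneg_right (hge n) (norm_nonneg _)
    have hs : ∀ a : (Fin c → ℤ) → ℂ, Summable (fun n => g n * ‖a n‖) →
        Summable fun n => ‖upow c u n * a n‖ := fun a ha =>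
      Summable.of_nonneg_of_le (fun n => norm_nonneg _) (hle a) ha
    refine ⟨hs, ⟨1, fun a ha => ?_⟩, fun a b ha hb => ?_, ?_⟩
    · rw [one_mul]
      exact (norm_tsum_le_tsum_norm (hs a ha)).trans ((hs a ha).tsum_le_tsum (hle a) ha)
    · rw [← conv_aux c _ _ (hs a ha) (hs b hb)]
      refine tsum_congr fun k => ?_
      rw [convC, ← tsum_mul_left]
      refine tsum_congr fun m => ?_
      have := upow_add_aux c u hu m (k - m)
      rw [add_sub_cancel] at this
      rw [this]
      ring
    · rw [tsum_eq_single 0]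
      · simp [upow, deltaC]
      · intro m hm
        simp [deltaC, hm]
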